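/- With the algorithm setup (n = dℓ): let 1 ≤ s ≤ ℓ and I ∈ L_s. If a < b < c < d are elements of [n] with a, c ∈ I and b, d ∈ P_s \ I, then b ∈ ā_{a_s} or d ∈ ā_{a_s}. -/

import Mathlib

open Finset

/-- `x +_n t`: add `t` to `x ∈ [n] = {1,…,n}` modulo `n`, with representative in `[n]`. -/
def shiftMod (n t x : ℕ) : ℕ := (x + t - 1) % n + 1

/-- `S +_n t`: add `t` to every element of `S ⊆ [n]` modulo `n`. -/
def shiftSet (n t : ℕ) (S : Finset ℕ) : Finset ℕ := S.image (shiftMod n t)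

/-- `x +_n t` for an integer shift `t`. -/
def shiftModZ (n : ℕ) (t : ℤ) (x : ℕ) : ℕ := ((((x : ℤ) + t - 1) % (n : ℤ)) + 1).toNat

/-- `S +_n t` for an integer shift `t`. -/
def shiftSetZ (n : ℕ) (t : ℤ) (S : Finset ℕ) : Finset ℕ := S.image (shiftModZ n t)

/-- Two sets `S`, `T` are weakly separated if there are no `a < b < c < d` with
`a, c ∈ S \ T` and `b, d ∈ T \ S`, nor with the roles of `S` and `T` exchanged. -/
def WeaklySeparated (S T : Finset ℕ) : Prop :=
  ¬ ∃ a b c d : ℕ, a < b ∧ b < c ∧ c < d ∧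
    ((a ∈ S \ T ∧ c ∈ S \ T ∧ b ∈ T \ S ∧ d ∈ T \ S) ∨
     (a ∈ T \ S ∧ c ∈ T \ S ∧ b ∈ S \ T ∧ d ∈ S \ T))

/-- The cyclic successor of `x` in a finite set `P ⊆ ℕ`: the least element of `P`
greater than `x` if one exists, and otherwise the least element of `P`. -/
def cyclicSucc (P : Finset ℕ) (x : ℕ) : ℕ :=
  if h : (P.filter (fun y => x < y)).Nonempty then (P.filter (fun y => x < y)).min' h
  else if h2 : P.Nonempty then P.min' h2 else 0

open scoped Classical in
/-- The cyclic interval of `P` from `u` to `v`: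
`{u, S_P(u), …, S_P^m(u)}` where `m ≥ 0` is minimal with `S_P^m(u) = v`. -/
noncomputable def cyclicIntervalTo (P : Finset ℕ) (u v : ℕ) : Finset ℕ :=
  if h : ∃ m : ℕ, (cyclicSucc P)^[m] u = v then
    (Finset.range (Nat.find h + 1)).image (fun j => (cyclicSucc P)^[j] u)
  else ∅

/-- The orbit `ā = {a + iℓ : 0 ≤ i ≤ d−1} ⊆ [dℓ]` of `a ∈ [ℓ]`. -/
def orbit (d ℓ a : ℕ) : Finset ℕ := (Finset.range d).image (fun i => a + i * ℓ)

/-- `P_s = [n] \ (ā_{a_1} ∪ … ∪ ā_{a_{s−1}})`, where `n = dℓ`. -/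
def Pset (d ℓ : ℕ) (a : ℕ → ℕ) (s : ℕ) : Finset ℕ :=
  Finset.Icc 1 (d * ℓ) \ (Finset.Icc 1 (s - 1)).biUnion (fun i => orbit d ℓ (a i))

/-- `P_{s,h} = P_s \ {a_s +_n hℓ, …, a_s +_n (d−1)ℓ}` for `1 ≤ h ≤ d−1`; `P_{s,d} = P_s`. -/
def Psh (d ℓ : ℕ) (a : ℕ → ℕ) (s h : ℕ) : Finset ℕ :=
  Pset d ℓ a s \ (Finset.Ico h d).image (fun j => shiftMod (d * ℓ) (j * ℓ) (a s))

/-- `I(i,h) = {i, S_{P_{s,h}}(i), S_{P_{s,h}}²(i), …, S_{P_{s,h}}^{k−1}(i)}`. -/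
def Iih (d ℓ k : ℕ) (a : ℕ → ℕ) (s h i : ℕ) : Finset ℕ :=
  (Finset.range k).image (fun j => (cyclicSucc (Psh d ℓ a s h))^[j] i)

/-- `B_s = {I(i,h) : i` in the cyclic interval of `P_s` from `S_{P_s}(a_s +_n (n−ℓ))` to
`a_s`, `1 ≤ h ≤ d`, `|I(i,h)| = k}`. -/
noncomputable def Bset (d ℓ k : ℕ) (a : ℕ → ℕ) (s : ℕ) : Finset (Finset ℕ) :=
  (((cyclicIntervalTo (Pset d ℓ a s)
        (cyclicSucc (Pset d ℓ a s) (shiftMod (d * ℓ) (d * ℓ - ℓ) (a s)))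
        (a s)) ×ˢ (Finset.Icc 1 d)).image
      (fun p => Iih d ℓ k a s p.2 p.1)).filter (fun I => I.card = k)

/-- `L_s = {I +_n xℓ : I ∈ B_s, 1 ≤ x ≤ d}`. -/
noncomputable def Lset (d ℓ k : ℕ) (a : ℕ → ℕ) (s : ℕ) : Finset (Finset ℕ) :=
  ((Bset d ℓ k a s) ×ˢ (Finset.Icc 1 d)).image (fun p => shiftSet (d * ℓ) (p.2 * ℓ) p.1)

/-- The output collection `D = L_1 ∪ … ∪ L_{ℓ−r+1}`. -/
noncomputable def Dcol (d ℓ k r : ℕ) (a : ℕ → ℕ) : Finset (Finset ℕ) :=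
  (Finset.Icc 1 (ℓ - r + 1)).biUnion (fun s => Lset d ℓ k a s)

/-- The map `F : [n] → [dℓ]`, `F(a + gx) = a + ℓx` for `1 ≤ a ≤ g`, `0 ≤ x ≤ d−1`. -/
def Fmap (g ℓ y : ℕ) : ℕ := (y - 1) % g + 1 + ℓ * ((y - 1) / g)

/-- The number of steps from `i` forward to `y` around the cycle `[n]`. -/
def cyclicDist (n i y : ℕ) : ℕ := if i ≤ y then y - i else y + n - i

lemma shiftMod_mem_Icc {n : ℕ} (hn : 0 < n) (t y : ℕ) : shiftMod n t y ∈ Icc 1 n := by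
  have := Nat.mod_lt (y + t - 1) hn
  simp only [shiftMod, mem_Icc]
  omega

lemma shiftMod_eq_or {n t y : ℕ} (ht : t ≤ n) (hy : y ∈ Icc 1 n) :
    (y + t ≤ n ∧ shiftMod n t y = y + t) ∨ (n < y + t ∧ shiftMod n t y + n = y + t) := by
  rw [mem_Icc] at hy
  unfold shiftMod
  rcases le_or_gt (y + t) n with h | h
  · rw [Nat.mod_eq_of_lt (by omega)]
    omega
  · rw [Nat.mod_eq_sub_mod (by omega), Nat.mod_eq_of_lt (by omega)]
    omega

lemma shiftMod_modEq {n ℓ t y : ℕ} (hn : ℓ ∣ n) (ht : ℓ ∣ t) (hy : 1 ≤ y) :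
    shiftMod n t y ≡ y [MOD ℓ] := by
  obtain ⟨y, rfl⟩ := Nat.exists_eq_add_of_le' hy
  have h : y + 1 + t - 1 = y + t := by omega
  rw [shiftMod, h]
  refine Nat.ModEq.add_right 1 (((Nat.mod_modEq _ n).of_dvd hn).trans ?_)
  simpa using ((Nat.modEq_zero_iff_dvd.2 ht).add_left y)

/-- The cyclic order of `[n]` is invariant under rotation. -/
lemma cyclicDist_shiftMod {n t i y : ℕ} (ht : t ≤ n) (hi : i ∈ Icc 1 n) (hy : y ∈ Icc 1 n) :
    cyclicDist n (shiftMod n t i) (shiftMod n t y) = cyclicDist n i y := by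
  have h₁ := shiftMod_eq_or ht hi
  have h₂ := shiftMod_eq_or ht hy
  rw [mem_Icc] at hi hy
  unfold cyclicDist
  split_ifs <;> omega

/-- Two points that both precede two others in the cyclic order from `i` do not cross them. -/
lemma not_crossing_of_cyclicDist_lt {n i w x y z : ℕ} (hi : i ∈ Icc 1 n) (hw : w ∈ Icc 1 n)
    (hz : z ∈ Icc 1 n) (hwx : w < x) (hxy : x < y) (hyz : y < z)
    (h₁ : cyclicDist n i w < cyclicDist n i x) (h₂ : cyclicDist n i w < cyclicDist n i z)
    (h₃ : cyclicDist n i y < cyclicDist n i x) (h₄ : cyclicDist n i y < cyclicDist n i z) :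
    False := by
  rw [mem_Icc] at hi hw hz
  unfold cyclicDist at h₁ h₂ h₃ h₄
  split_ifs at h₁ h₂ h₃ h₄ <;> omega

lemma mem_orbit_iff {d ℓ b y : ℕ} (hb : b ∈ Set.Icc 1 ℓ) :
    y ∈ orbit d ℓ b ↔ y ∈ Icc 1 (d * ℓ) ∧ y ≡ b [MOD ℓ] := by
  obtain ⟨hb₁, hb₂⟩ := hb
  simp only [orbit, mem_image, mem_range, mem_Icc]
  constructor
  · rintro ⟨i, hi, rfl⟩
    have : (i + 1) * ℓ ≤ d * ℓ := Nat.mul_le_mul_right ℓ hi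
    refine ⟨⟨by omega, by linarith⟩, ?_⟩
    simp [Nat.ModEq]
  · rintro ⟨⟨hy₁, hy₂⟩, h⟩
    have hby : b ≤ y := by
      by_contra! hlt
      obtain ⟨c, hc⟩ := (Nat.modEq_iff_dvd' hlt.le).1 h
      rcases c with _ | c
      · omega
      · rw [Nat.mul_succ] at hc
        omega
    obtain ⟨c, hc⟩ := (Nat.modEq_iff_dvd' hby).1 h.symm
    refine ⟨c, ?_, by rw [Nat.mul_comm]; omega⟩
    by_contra! hdc
    have : d * ℓ ≤ c * ℓ := Nat.mul_le_mul_right ℓ hdc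
    rw [Nat.mul_comm] at hc
    omega

lemma cyclicSucc_mem {P : Finset ℕ} (hP : P.Nonempty) (x : ℕ) : cyclicSucc P x ∈ P := by
  unfold cyclicSucc
  split_ifs with h
  · exact mem_of_mem_filter _ (min'_mem _ h)
  · exact min'_mem _ _

/-- No element of `P` lies strictly between `q` and its cyclic successor. -/
lemma eq_cyclicSucc_of_cyclicDist {n i q p : ℕ} {P : Finset ℕ} (hP : P ⊆ Icc 1 n)
    (hi : i ∈ Icc 1 n) (hq : q ∈ Icc 1 n) (hp : p ∈ P)
    (h₁ : cyclicDist n i q < cyclicDist n i p)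
    (h₂ : cyclicDist n i p ≤ cyclicDist n i (cyclicSucc P q)) : p = cyclicSucc P q := by
  have hpn := hP hp
  have hsn := hP (cyclicSucc_mem ⟨p, hp⟩ q)
  have hle : (q < p → q < cyclicSucc P q ∧ cyclicSucc P q ≤ p) ∧
      (q < cyclicSucc P q ∨ cyclicSucc P q ≤ p) := by
    unfold cyclicSucc
    split_ifs with h h'
    · have hm := (mem_filter.1 (min'_mem _ h)).2
      exact ⟨fun hqp => ⟨hm, min'_le _ _ (mem_filter.2 ⟨hp, hqp⟩)⟩, Or.inl hm⟩
    · exact ⟨fun hqp => (h ⟨p, mem_filter.2 ⟨hp, hqp⟩⟩).elim, Or.inr (min'_le _ _ hp)⟩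
    · exact (h' ⟨p, hp⟩).elim
  rw [mem_Icc] at hpn hsn hi hq
  unfold cyclicDist at h₁ h₂
  split_ifs at h₁ h₂ <;> omega

lemma iterate_cyclicSucc_mem {A P : Finset ℕ} (hP : P.Nonempty) (hPA : P ⊆ A) {i : ℕ}
    (hi : i ∈ A) (j : ℕ) : (cyclicSucc P)^[j] i ∈ A := by
  cases j with
  | zero => exact hi
  | succ j =>
    rw [Function.iterate_succ_apply']
    exact hPA (cyclicSucc_mem hP _)

/-- Iterating the cyclic successor from `i` misses no element of `P` on the way. -/
lemma exists_iterate_cyclicSucc_eq {n i p : ℕ} {P : Finset ℕ} (hP : P ⊆ Icc 1 n)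
    (hi : i ∈ Icc 1 n) (hp : p ∈ P) (j : ℕ)
    (h : cyclicDist n i p ≤ cyclicDist n i ((cyclicSucc P)^[j] i)) :
    ∃ j' ≤ j, (cyclicSucc P)^[j'] i = p := by
  induction j with
  | zero =>
    refine ⟨0, le_rfl, ?_⟩
    have hpn := hP hp
    rw [mem_Icc] at hi hpn
    simp only [Function.iterate_zero, id, cyclicDist, le_refl, if_true] at h ⊢
    split_ifs at h <;> omega
  | succ j ih =>
    by_cases hj : cyclicDist n i p ≤ cyclicDist n i ((cyclicSucc P)^[j] i)
    · obtain ⟨j', hj', e⟩ := ih hj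
      exact ⟨j', by omega, e⟩
    · rw [Function.iterate_succ_apply'] at h
      refine ⟨j + 1, le_rfl, ?_⟩
      rw [Function.iterate_succ_apply']
      exact (eq_cyclicSucc_of_cyclicDist hP hi
        (iterate_cyclicSucc_mem ⟨p, hp⟩ hP hi j) hp (not_le.1 hj) h).symm

lemma cyclicDist_lt_of_mem_Iih {d ℓ k : ℕ} {a : ℕ → ℕ} {s h i y p : ℕ}
    (hi : i ∈ Icc 1 (d * ℓ)) (hy : y ∈ Iih d ℓ k a s h i)
    (hp : p ∈ Psh d ℓ a s h) (hpI : p ∉ Iih d ℓ k a s h i) :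
    cyclicDist (d * ℓ) i y < cyclicDist (d * ℓ) i p := by
  by_contra! hle
  obtain ⟨j, hj, rfl⟩ := mem_image.1 hy
  obtain ⟨j', hj', e⟩ := exists_iterate_cyclicSucc_eq
    (sdiff_subset.trans sdiff_subset) hi hp j hle
  exact hpI (mem_image.2 ⟨j', mem_range.2 (hj'.trans_lt (mem_range.1 hj)), e⟩)

lemma cyclicIntervalTo_subset {P : Finset ℕ} {u v : ℕ} (hu : u ∈ P) :
    cyclicIntervalTo P u v ⊆ P := by
  unfold cyclicIntervalTo
  split_ifs
  · intro i hi
    obtain ⟨j, -, rfl⟩ := mem_image.1 hi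
    exact iterate_cyclicSucc_mem ⟨u, hu⟩ subset_rfl hu j
  · exact empty_subset _

/-- An element of `P_s` outside the orbit of `a_s` is a rotation of an element of `P_{s,h}`. -/
lemma exists_mem_Psh_shiftMod_eq {d ℓ : ℕ} {a : ℕ → ℕ}
    (ha : Set.MapsTo a (Set.Icc 1 ℓ) (Set.Icc 1 ℓ)) {s : ℕ} (hs₁ : 1 ≤ s) (hs₂ : s ≤ ℓ)
    (h : ℕ) {c : ℕ} (hc : c ≤ d) {x : ℕ} (hx : x ∈ Pset d ℓ a s)
    (hxo : x ∉ orbit d ℓ (a s)) :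
    ∃ x' ∈ Psh d ℓ a s h, shiftMod (d * ℓ) (c * ℓ) x' = x := by
  obtain ⟨hxn, hxU⟩ := mem_sdiff.1 hx
  have hn : 0 < d * ℓ := by rw [mem_Icc] at hxn; omega
  have hcn : c * ℓ ≤ d * ℓ := Nat.mul_le_mul_right ℓ hc
  have hc'n : d * ℓ - c * ℓ ≤ d * ℓ := Nat.sub_le _ _
  have hdvd : ℓ ∣ d * ℓ - c * ℓ := Nat.dvd_sub (dvd_mul_left _ _) (dvd_mul_left _ _)
  have hx'n := shiftMod_mem_Icc hn (d * ℓ - c * ℓ) x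
  have hmod := shiftMod_modEq (dvd_mul_left ℓ d) hdvd (mem_Icc.1 hxn).1
  have has := ha ⟨hs₁, hs₂⟩
  refine ⟨shiftMod (d * ℓ) (d * ℓ - c * ℓ) x, ?_, ?_⟩
  · refine mem_sdiff.2 ⟨mem_sdiff.2 ⟨hx'n, fun hU => hxU ?_⟩, fun hJ => hxo ?_⟩
    · obtain ⟨j, hj, hjo⟩ := mem_biUnion.1 hU
      have hj' := mem_Icc.1 hj
      have haj := ha (show j ∈ Set.Icc 1 ℓ from ⟨hj'.1, by omega⟩)
      exact mem_biUnion.2 ⟨j, hj, (mem_orbit_iff haj).2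
        ⟨hxn, hmod.symm.trans ((mem_orbit_iff haj).1 hjo).2⟩⟩
    · obtain ⟨j, -, e⟩ := mem_image.1 hJ
      rw [← e] at hmod
      exact (mem_orbit_iff has).2 ⟨hxn, hmod.symm.trans
        (shiftMod_modEq (dvd_mul_left ℓ d) (dvd_mul_left ℓ j) has.1)⟩
  · have h₁ := shiftMod_eq_or hc'n hxn
    have h₂ := shiftMod_eq_or hcn hx'n
    rw [mem_Icc] at hxn hx'n
    omega

lemma cyclicDist_lt_of_mem_shiftSet {d ℓ k : ℕ} {a : ℕ → ℕ}
    (ha : Set.MapsTo a (Set.Icc 1 ℓ) (Set.Icc 1 ℓ)) {s : ℕ} (hs₁ : 1 ≤ s) (hs₂ : s ≤ ℓ)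
    {h i c u v : ℕ} (hc : c ≤ d) (hi : i ∈ Icc 1 (d * ℓ))
    (hu : u ∈ shiftSet (d * ℓ) (c * ℓ) (Iih d ℓ k a s h i)) (hv : v ∈ Pset d ℓ a s)
    (hvI : v ∉ shiftSet (d * ℓ) (c * ℓ) (Iih d ℓ k a s h i)) (hvo : v ∉ orbit d ℓ (a s)) :
    cyclicDist (d * ℓ) (shiftMod (d * ℓ) (c * ℓ) i) u <
      cyclicDist (d * ℓ) (shiftMod (d * ℓ) (c * ℓ) i) v := by
  have ht : c * ℓ ≤ d * ℓ := Nat.mul_le_mul_right ℓ hc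
  obtain ⟨u, huI, rfl⟩ := mem_image.1 hu
  obtain ⟨v, hvP, rfl⟩ := exists_mem_Psh_shiftMod_eq ha hs₁ hs₂ h hc hv hvo
  have hPn : Psh d ℓ a s h ⊆ Icc 1 (d * ℓ) := sdiff_subset.trans sdiff_subset
  have hun : u ∈ Icc 1 (d * ℓ) := by
    obtain ⟨j, -, rfl⟩ := mem_image.1 huI
    exact iterate_cyclicSucc_mem ⟨v, hvP⟩ hPn hi j
  rw [cyclicDist_shiftMod ht hi hun, cyclicDist_shiftMod ht hi (hPn hvP)]
  exact cyclicDist_lt_of_mem_Iih hi huI hvP fun hvJ => hvI (mem_image_of_mem _ hvJ)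

lemma exists_eq_shiftSet_of_mem_Lset {d ℓ k : ℕ} {a : ℕ → ℕ} {s : ℕ} {I : Finset ℕ}
    (hP : (Pset d ℓ a s).Nonempty) (hI : I ∈ Lset d ℓ k a s) :
    ∃ i ∈ Icc 1 (d * ℓ), ∃ h, ∃ c ≤ d,
      I = shiftSet (d * ℓ) (c * ℓ) (Iih d ℓ k a s h i) := by
  simp only [Lset, Bset, mem_image, mem_product, mem_filter, Prod.exists] at hI
  obtain ⟨J, c, ⟨⟨⟨i, h, ⟨hi, -⟩, rfl⟩, -⟩, hc⟩, rfl⟩ := hI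
  exact ⟨i, sdiff_subset (cyclicIntervalTo_subset (cyclicSucc_mem hP _) hi), h, c,
    (mem_Icc.1 hc).2, rfl⟩

/-- With the algorithm setup (`n = dℓ`): let `1 ≤ s ≤ ℓ` and
`I ∈ L_s`. If `w < x < y < z` are elements of `[n]` with `w, y ∈ I` and
`x, z ∈ P_s \ I`, then `x ∈ ā_{a_s}` or `z ∈ ā_{a_s}`. -/
theorem stmt10 (d ℓ k : ℕ) (hd : 1 ≤ d) (hl : 1 ≤ ℓ) (hk1 : 1 ≤ k) (hk2 : 2 * k ≤ d * ℓ)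
    (a : ℕ → ℕ) (ha : Set.BijOn a (Set.Icc 1 ℓ) (Set.Icc 1 ℓ))
    (s : ℕ) (hs1 : 1 ≤ s) (hs2 : s ≤ ℓ)
    (I : Finset ℕ) (hI : I ∈ Lset d ℓ k a s)
    (w x y z : ℕ)
    (hwn : w ∈ Finset.Icc 1 (d * ℓ)) (hxn : x ∈ Finset.Icc 1 (d * ℓ))
    (hyn : y ∈ Finset.Icc 1 (d * ℓ)) (hzn : z ∈ Finset.Icc 1 (d * ℓ))
    (hwx : w < x) (hxy : x < y) (hyz : y < z)
    (hwI : w ∈ I) (hyI : y ∈ I)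
    (hxP : x ∈ Pset d ℓ a s \ I) (hzP : z ∈ Pset d ℓ a s \ I) :
    x ∈ orbit d ℓ (a s) ∨ z ∈ orbit d ℓ (a s) := by
  by_contra! hno
  obtain ⟨hxo, hzo⟩ := hno
  obtain ⟨hxs, hxI⟩ := mem_sdiff.1 hxP
  obtain ⟨hzs, hzI⟩ := mem_sdiff.1 hzP
  obtain ⟨i, hi, h, c, hcd, rfl⟩ := exists_eq_shiftSet_of_mem_Lset ⟨x, hxs⟩ hI
  have hn : 0 < d * ℓ := Nat.mul_pos hd hl
  have key := fun u v => cyclicDist_lt_of_mem_shiftSet (k := k) (u := u) (v := v) ha.mapsTo hs1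
    hs2 (h := h) hcd hi
  have h₁ := key w x hwI hxs hxI hxo
  have h₂ := key w z hwI hzs hzI hzo
  have h₃ := key y x hyI hxs hxI hxo
  have h₄ := key y z hyI hzs hzI hzo
  exact not_crossing_of_cyclicDist_lt (shiftMod_mem_Icc hn (c * ℓ) i) hwn hzn hwx hxy hyz
    h₁ h₂ h₃ h₄
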